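/- Consider a classical channel N on finite sets X, Y with supports X_y = {x : N(y|x) > 0}, an encoding given by pairwise disjoint nonempty subsets X_m ⊆ X for m in a finite message set Msg with prior π, and the confusability function η(x,x') := ∑_{y : x'∈X_y} N(y|x). Let Λ be a finite set, ν a probability distribution on Λ, and suppose: (i) for each λ ∈ Λ, ξ(·|λ) : X → [0,1] satisfies ∑_{x∈X_y} ξ(x|λ) = 1 for every y ∈ Y and ∑_{x∈X_m} ξ(x|λ) = 1 for every m ∈ Msg (measurement-noncontextual response functions on the contextuality scenario); (ii) for each m and λ, μ(·|m,λ) is a probability distribution on X_m. Then the noncontextual success probability S := ∑_{λ} ν(λ) ∑_m π(m) ∑_{x,x'∈X_m} ξ(x'|λ)·μ(x|m,λ)·η(x,x') satisfies S ≤ S_Cl(CIG)^max, where S_Cl(CIG)^max is the maximum over all pairs (a, r) — with a(·|m) a probability distribution on X_m for each m, and r : X → [0,1] satisfying ∑_{x∈X_y} r(x) = 1 for every y ∈ Y and ∑_{x∈X_m} r(x) = 1 for every m — of ∑_m π(m) ∑_{x,x'∈X_m} a(x|m)·r(x')·η(x,x'). -/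

import Mathlib

/-- A bilinear average, over a probability weight `a` and a normalised nonnegative weight `r`,
of a kernel bounded by `1` is at most `1`. -/
theorem sum_sum_mul_le_one {X : Type*} (s : Finset X) (a r : X → ℝ) (η : X → X → ℝ)
    (ha : ∀ x ∈ s, 0 ≤ a x) (hasum : ∑ x ∈ s, a x = 1)
    (hr : ∀ x ∈ s, 0 ≤ r x) (hrsum : ∑ x ∈ s, r x = 1) (hη : ∀ x x', η x x' ≤ 1) :
    ∑ x ∈ s, ∑ x' ∈ s, a x * r x' * η x x' ≤ 1 :=
  calc ∑ x ∈ s, ∑ x' ∈ s, a x * r x' * η x x'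
      ≤ ∑ x ∈ s, ∑ x' ∈ s, a x * r x' :=
        Finset.sum_le_sum fun x hx => Finset.sum_le_sum fun x' hx' =>
          mul_le_of_le_one_right (mul_nonneg (ha x hx) (hr x' hx')) (hη x x')
    _ = 1 := by rw [← Finset.sum_mul_sum, hasum, hrsum, one_mul]

/-- A weighted average of numbers bounded by `c` is bounded by `c`. -/
theorem sum_mul_le_of_forall_le {ι : Type*} [Fintype ι] (w f : ι → ℝ) (c : ℝ)
    (hw : ∀ i, 0 ≤ w i) (hwsum : ∑ i, w i = 1) (hf : ∀ i, f i ≤ c) :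
    ∑ i, w i * f i ≤ c :=
  calc ∑ i, w i * f i ≤ ∑ i, w i * c :=
        Finset.sum_le_sum fun i _ => mul_le_mul_of_nonneg_left (hf i) (hw i)
    _ = c := by rw [← Finset.sum_mul, hwsum, one_mul]


/-- the success probability of any (preparation and
measurement) noncontextual ontological model is bounded by the best classical
strategy satisfying context-independent guessing, `S ≤ S_Cl(CIG)^max`.
The confusability is `η(x,x') = ∑_{y : x'∈X_y} N(y|x)`, where
`X_y = {x : N(y|x) > 0}`. -/
theorem noncontextual_success_le_classical_CIG
    {X Y Msg : Type*} [Fintype X] [Fintype Y] [Fintype Msg]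
    [Nonempty X] [Nonempty Y] [Nonempty Msg]
    (N : X → Y → ℝ) (hN : ∀ x y, 0 ≤ N x y) (hNsum : ∀ x, ∑ y, N x y = 1)
    (Xm : Msg → Finset X) (hXmne : ∀ m, (Xm m).Nonempty)
    (hdisj : ∀ m m', m ≠ m' → Disjoint (Xm m) (Xm m'))
    (π : Msg → ℝ) (hπ : ∀ m, 0 ≤ π m) (hπsum : ∑ m, π m = 1)
    {Λ : Type*} [Fintype Λ]
    (ν : Λ → ℝ) (hν : ∀ l, 0 ≤ ν l) (hνsum : ∑ l, ν l = 1)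
    (ξ : Λ → X → ℝ) (hξ0 : ∀ l x, 0 ≤ ξ l x) (hξ1 : ∀ l x, ξ l x ≤ 1)
    (hξY : ∀ l y, ∑ x ∈ Finset.univ.filter (fun x => 0 < N x y), ξ l x = 1)
    (hξM : ∀ l m, ∑ x ∈ Xm m, ξ l x = 1)
    (μ : Msg → Λ → X → ℝ)
    (hμ0 : ∀ m l, ∀ x ∈ Xm m, 0 ≤ μ m l x)
    (hμsum : ∀ m l, ∑ x ∈ Xm m, μ m l x = 1) :
    (∑ l, ν l * ∑ m, π m * ∑ x ∈ Xm m, ∑ x' ∈ Xm m,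
        ξ l x' * μ m l x * (∑ y, if 0 < N x' y then N x y else 0))
      ≤ sSup {v : ℝ | ∃ (a : Msg → X → ℝ) (r : X → ℝ),
          (∀ m, ∀ x ∈ Xm m, 0 ≤ a m x) ∧ (∀ m, ∑ x ∈ Xm m, a m x = 1) ∧
          (∀ x, 0 ≤ r x ∧ r x ≤ 1) ∧
          (∀ y, ∑ x ∈ Finset.univ.filter (fun x => 0 < N x y), r x = 1) ∧
          (∀ m, ∑ x ∈ Xm m, r x = 1) ∧
          v = ∑ m, π m * ∑ x ∈ Xm m, ∑ x' ∈ Xm m,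
                a m x * r x' * (∑ y, if 0 < N x' y then N x y else 0)} := by
  have hη : ∀ x x', (∑ y, if 0 < N x' y then N x y else 0) ≤ 1 := by
    intro x x'
    rw [← hNsum x]
    refine Finset.sum_le_sum fun y _ => ?_
    split_ifs
    exacts [le_rfl, hN x y]
  refine sum_mul_le_of_forall_le ν _ _ hν hνsum fun l => le_csSup ⟨1, ?_⟩ ?_
  · rintro v ⟨a, r, ha, hasum, hr, -, hrM, rfl⟩
    exact sum_mul_le_of_forall_le π _ _ hπ hπsum fun m =>
      sum_sum_mul_le_one (Xm m) (a m) r _ (ha m) (hasum m) (fun x _ => (hr x).1) (hrM m) hη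
  · refine ⟨fun m => μ m l, ξ l, fun m => hμ0 m l, fun m => hμsum m l,
      fun x => ⟨hξ0 l x, hξ1 l x⟩, hξY l, hξM l, ?_⟩
    simp only [mul_comm (ξ l _)]
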